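/- Define matrices U, K ∈ Mat_{N+1}(F) (rows and columns indexed by 0,1,…,N) by U_{ij} = K_i(j) and K = diag(k_0, k_1, …, k_N) with k_i = C(N,i)·(p/(1−p))ⁱ. Then (1−p)^N · U·K·U·K = I; equivalently, the matrix P = U·K satisfies P² = (1−p)^{−N}·I. -/

import Mathlib

open Finset Matrix

/-- The Krawtchouk polynomial value
`K_i(j) = Σ_{n=0}^{N} (−i)_n (−j)_n / ((−N)_n · n! · pⁿ)`, computed in the field `F`,
where `(α)_n` is the shifted factorial (ascending Pochhammer symbol). -/
noncomputable def kraw (F : Type*) [Field F] (p : F) (N i j : ℕ) : F :=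
  ∑ n ∈ Finset.range (N + 1),
    ((ascPochhammer F n).eval (-(i : F)) * (ascPochhammer F n).eval (-(j : F))) /
      ((ascPochhammer F n).eval (-(N : F)) * (n.factorial : F) * p ^ n)

theorem eval_neg_natCast_ascPochhammer {R : Type*} [CommRing R] (n m : ℕ) :
    (ascPochhammer R n).eval (-(m : R)) = (-1) ^ n * (n.factorial : R) * (m.choose n : R) := by
  rw [ascPochhammer_eval_neg_eq_descPochhammer, descPochhammer_eval_eq_descFactorial,
    Nat.descFactorial_eq_factorial_mul_choose]
  push_cast
  ring

theorem natCast_choose_ne_zero_of_factorial {F : Type*} [Field F] {N n : ℕ}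
    (hN : (N.factorial : F) ≠ 0) (hn : n ≤ N) : (N.choose n : F) ≠ 0 := by
  intro h
  apply hN
  rw [← Nat.choose_mul_factorial_mul_factorial hn]
  simp [h]

theorem kraw_eq_sum_choose {F : Type*} [Field F] {N : ℕ} (hN : (N.factorial : F) ≠ 0)
    (p : F) (i j : ℕ) :
    kraw F p N i j = ∑ n ∈ range (N + 1),
      (i.choose n : F) * (-1 / p) ^ n * ((j.choose n : F) / (N.choose n : F)) := by
  refine sum_congr rfl fun n hn => ?_
  have hn : n ≤ N := Nat.lt_succ_iff.mp (mem_range.mp hn)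
  have hc := natCast_choose_ne_zero_of_factorial hN hn
  have hf : (n.factorial : F) ≠ 0 := by
    intro h
    apply hN
    rw [← Nat.choose_mul_factorial_mul_factorial hn]
    simp [h]
  have hs : ((-1 : F) ^ n) ≠ 0 := pow_ne_zero _ (by simp)
  simp only [eval_neg_natCast_ascPochhammer, div_pow]
  by_cases hp : p ^ n = 0
  · simp [hp]
  · field_simp

/-- The binomial theorem weighted by `C(j, n)`. -/
theorem sum_choose_mul_choose_mul_pow {R : Type*} [CommRing R] {n N : ℕ} (hn : n ≤ N) (a x : R) :
    ∑ j ∈ range (N + 1), (N.choose j : R) * (j.choose n : R) * (x ^ j * a ^ (N - j)) =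
      (N.choose n : R) * (x ^ n * (x + a) ^ (N - n)) := by
  obtain ⟨m, rfl⟩ := Nat.exists_eq_add_of_le hn
  rw [add_assoc, sum_range_add, sum_eq_zero, zero_add, add_tsub_cancel_left, add_pow, mul_sum,
    mul_sum]
  · refine sum_congr rfl fun k hk => ?_
    have hk : k ≤ m := Nat.lt_succ_iff.mp (mem_range.mp hk)
    have h := Nat.choose_mul (n := n + m) (k := n + k) (s := n) (by omega)
    rw [add_tsub_cancel_left, add_tsub_cancel_left] at h
    rw [← Nat.cast_mul, h, Nat.add_sub_add_left]
    push_cast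
    ring
  · intro j hj
    simp [Nat.choose_eq_zero_of_lt (mem_range.mp hj)]

open Polynomial in
/-- The generating function of the Krawtchouk values, in homogeneous form. -/
theorem sum_kraw_mul_pow {F : Type*} [Field F] {N i : ℕ} (hN : (N.factorial : F) ≠ 0)
    {p : F} (hp0 : p ≠ 0) (hp1 : p ≠ 1) (hi : i ≤ N) (a b : F[X]) :
    ∑ j ∈ range (N + 1),
      C (kraw F p N i j * ((N.choose j : F) * (p / (1 - p)) ^ j)) * (b ^ j * a ^ (N - j)) =
      (a - b) ^ i * (C (p / (1 - p)) * b + a) ^ (N - i) := by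
  have hq : 1 - p ≠ 0 := sub_ne_zero.mpr hp1.symm
  set r := p / (1 - p) with hr
  have inner : ∀ n ∈ range (N + 1),
      ∑ j ∈ range (N + 1), C ((i.choose n : F) * (-1 / p) ^ n *
        ((j.choose n : F) / (N.choose n : F)) * ((N.choose j : F) * r ^ j)) *
          (b ^ j * a ^ (N - j)) =
      (C (-1 / p) * (C r * b)) ^ n * (C r * b + a) ^ (N - n) * (i.choose n : F[X]) := by
    intro n hn
    have hn : n ≤ N := Nat.lt_succ_iff.mp (mem_range.mp hn)
    have hc := natCast_choose_ne_zero_of_factorial hN hn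
    have hC : C ((N.choose n : F)⁻¹) * (N.choose n : F[X]) = 1 := by
      rw [← C_eq_natCast, ← C_mul, inv_mul_cancel₀ hc, C_1]
    calc _ = (i.choose n : F[X]) * C (-1 / p) ^ n * C ((N.choose n : F)⁻¹) *
          ∑ j ∈ range (N + 1), (N.choose j : F[X]) * (j.choose n : F[X]) *
            ((C r * b) ^ j * a ^ (N - j)) := by
          rw [mul_sum]
          refine sum_congr rfl fun j _ => ?_
          simp only [div_eq_mul_inv (j.choose n : F), C_mul, C_pow, C_eq_natCast]
          ring
      _ = _ := by
          rw [sum_choose_mul_choose_mul_pow hn]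
          linear_combination ((i.choose n : F[X]) * C (-1 / p) ^ n *
            ((C r * b) ^ n * (C r * b + a) ^ (N - n))) * hC
  have hab : C (-1 / p) * (C r * b) + (C r * b + a) = a - b := by
    have h : -1 / p * r + r = -1 := by
      rw [hr]
      field_simp
      ring
    have hC : C (-1 / p) * C r + C r = (-1 : F[X]) := by
      rw [← C_mul, ← C_add, h, C_neg, C_1]
    linear_combination b * hC
  simp only [kraw_eq_sum_choose hN, sum_mul, map_sum]
  rw [sum_comm, sum_congr rfl inner, ← hab, add_pow, sum_mul]
  symm
  apply sum_subset_zero_on_sdiff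
  · exact range_subset_range.mpr (by omega)
  · intro n hn
    have : i < n := by simp at hn; omega
    simp [Nat.choose_eq_zero_of_lt this]
  · intro n hn
    have hn : n ≤ i := Nat.lt_succ_iff.mp (mem_range.mp hn)
    rw [show N - n = (i - n) + (N - i) by omega, pow_add]
    ring

open Polynomial in
/-- Orthogonality of the Krawtchouk values. -/
theorem sum_kraw_mul_kraw {F : Type*} [Field F] {N i l : ℕ} (hN : (N.factorial : F) ≠ 0)
    {p : F} (hp0 : p ≠ 0) (hp1 : p ≠ 1) (hi : i ≤ N) (hl : l ≤ N) :
    ∑ j ∈ range (N + 1), kraw F p N i j * ((N.choose j : F) * (p / (1 - p)) ^ j) *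
      (kraw F p N j l * ((N.choose l : F) * (p / (1 - p)) ^ l)) =
      if i = l then ((1 - p) ^ N)⁻¹ else 0 := by
  have hq : 1 - p ≠ 0 := sub_ne_zero.mpr hp1.symm
  set r := p / (1 - p) with hr
  have hr1 : 1 + r = (1 - p)⁻¹ := by
    rw [hr]
    field_simp
    ring
  have key : ∑ j ∈ range (N + 1), C (kraw F p N i j * ((N.choose j : F) * r ^ j)) *
      ∑ m ∈ range (N + 1), C (kraw F p N j m * ((N.choose m : F) * r ^ m)) *
        (X ^ m * 1 ^ (N - m)) = C (((1 - p) ^ N)⁻¹) * X ^ i := by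
    have hC : 1 + C r = C (1 - p)⁻¹ := by rw [← hr1, C_add, C_1]
    have h1 : C r * X + 1 - (1 - X) = C (1 - p)⁻¹ * X := by rw [← hC]; ring
    have h2 : C r * (1 - X) + (C r * X + 1) = C (1 - p)⁻¹ := by rw [← hC]; ring
    rw [sum_congr rfl fun j hj => by
      rw [sum_kraw_mul_pow hN hp0 hp1 (Nat.lt_succ_iff.mp (mem_range.mp hj))],
      sum_kraw_mul_pow hN hp0 hp1 hi, h1, h2, ← inv_pow, C_pow]
    conv_rhs => rw [← Nat.add_sub_cancel' hi, pow_add]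
    ring
  have hcoeff := congrArg (fun f => coeff f l) key
  have hl' : l < N + 1 := by omega
  simpa [finsetSum_coeff, coeff_C_mul, coeff_X_pow, hl', -map_mul, eq_comm (a := l)] using hcoeff

/-- Let `U ∈ Mat_{N+1}(F)` have entries `U_{ij} = K_i(j)` and let
`K = diag(k_0, …, k_N)` with `k_i = C(N,i) (p/(1−p))ⁱ`.  Then
`(1−p)^N · U K U K = I`; equivalently `P = U K` satisfies `P² = (1−p)^{−N} I`.
Feasibility of `N` is encoded by `(N! : F) ≠ 0`. -/
theorem stmt16 (F : Type*) [Field F] (hchar : (2 : F) ≠ 0)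
    (N : ℕ) (hN : (N.factorial : F) ≠ 0)
    (p : F) (hp0 : p ≠ 0) (hp1 : p ≠ 1)
    (U K : Matrix (Fin (N + 1)) (Fin (N + 1)) F)
    (hU : ∀ i j : Fin (N + 1), U i j = kraw F p N i j)
    (hK : K = Matrix.diagonal fun i : Fin (N + 1) =>
      (N.choose i : F) * (p / (1 - p)) ^ (i : ℕ)) :
    (1 - p) ^ N • (U * K * U * K) = (1 : Matrix (Fin (N + 1)) (Fin (N + 1)) F) ∧
    (U * K) * (U * K) = ((1 - p) ^ N)⁻¹ • (1 : Matrix (Fin (N + 1)) (Fin (N + 1)) F) := by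
  have hq : (1 - p) ^ N ≠ 0 := pow_ne_zero _ (sub_ne_zero.mpr hp1.symm)
  have hsq : (U * K) * (U * K) =
      ((1 - p) ^ N)⁻¹ • (1 : Matrix (Fin (N + 1)) (Fin (N + 1)) F) := by
    ext i l
    rw [Matrix.mul_apply, hK]
    simp only [Matrix.mul_diagonal, hU, Matrix.smul_apply, Matrix.one_apply, smul_eq_mul,
      mul_ite, mul_one, mul_zero, Fin.ext_iff]
    rw [← sum_kraw_mul_kraw hN hp0 hp1 (Nat.lt_succ_iff.mp i.2) (Nat.lt_succ_iff.mp l.2),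
      ← Fin.sum_univ_eq_sum_range fun j =>
        kraw F p N i j * ((N.choose j : F) * (p / (1 - p)) ^ j) *
          (kraw F p N j l * ((N.choose l : F) * (p / (1 - p)) ^ (l : ℕ)))]
  refine ⟨?_, hsq⟩
  rw [Matrix.mul_assoc (U * K) U K, hsq, smul_smul, mul_inv_cancel₀ hq, one_smul]
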